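/- Let n ≥ 1 and define U_{n,1} = (1/√n) Σ_{i=1}^n I^{⊗(i-1)} ⊗ X ⊗ Z^{⊗(n-i)}. Then U_{n,1} is a unitary operator on (ℂ²)^{⊗n}, and U_{n,1} |0⟩^{⊗n} = |n,1⟩ = (1/√n) Σ_{i=1}^n |e_i⟩, where |e_i⟩ is the computational basis state whose i-th bit is 1 and all other bits are 0 (the n-qubit W state). -/

import Mathlib

open Matrix

/-- Pauli X matrix. -/
noncomputable def Xg : Matrix (Fin 2) (Fin 2) ℂ := !![0, 1; 1, 0]

/-- Pauli Z matrix. -/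
noncomputable def Zg : Matrix (Fin 2) (Fin 2) ℂ := !![1, 0; 0, -1]

/-- The `n`-fold tensor (Kronecker) product of single-qubit matrices. -/
noncomputable def tens {n : ℕ} (u : Fin n → Matrix (Fin 2) (Fin 2) ℂ) :
    Matrix (Fin n → Fin 2) (Fin n → Fin 2) ℂ :=
  fun x y => ∏ k, u k (x k) (y k)

/-- `p_i = I^{⊗(i-1)} ⊗ X ⊗ Z^{⊗(n-i)}`. -/
noncomputable def pOp {n : ℕ} (i : Fin n) :
    Matrix (Fin n → Fin 2) (Fin n → Fin 2) ℂ :=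
  tens fun k => if k < i then 1 else if k = i then Xg else Zg

/-- The zero state `|0̄⟩ = |0⟩^{⊗n}`. -/
noncomputable def zeroState (n : ℕ) : (Fin n → Fin 2) → ℂ :=
  fun x => if x = (fun _ => 0) then 1 else 0

/-- The computational basis state `|e_i⟩` whose `i`-th bit is `1` and all others `0`. -/
noncomputable def eSingle {n : ℕ} (i : Fin n) : (Fin n → Fin 2) → ℂ :=
  fun x => if x = (fun k => if k = i then 1 else 0) then 1 else 0

theorem tens_mul_aux {n : ℕ} (u v : Fin n → Matrix (Fin 2) (Fin 2) ℂ) :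
    tens u * tens v = tens (fun k => u k * v k) := by
  ext x y
  simp only [Matrix.mul_apply, tens]
  rw [Finset.prod_univ_sum, Fintype.piFinset_univ]
  simp only [Finset.prod_mul_distrib]

theorem tens_smul_aux {n : ℕ} (c : Fin n → ℂ) (v : Fin n → Matrix (Fin 2) (Fin 2) ℂ) :
    tens (fun k => c k • v k) = (∏ k, c k) • tens v := by
  ext x y
  simp [tens, Finset.prod_mul_distrib]

theorem tens_one_aux {n : ℕ} : tens (fun _ : Fin n => 1) = 1 := by
  ext x y
  simp only [tens, Matrix.one_apply, Finset.prod_ite_zero, funext_iff]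
  simp

theorem XX_aux : Xg * Xg = 1 := by
  ext i j; fin_cases i <;> fin_cases j <;> simp [Xg, Matrix.mul_apply]
theorem ZZ_aux : Zg * Zg = 1 := by
  ext i j; fin_cases i <;> fin_cases j <;> simp [Zg, Matrix.mul_apply]
theorem ZX_aux : Zg * Xg = (-1 : ℂ) • (Xg * Zg) := by
  ext i j; fin_cases i <;> fin_cases j <;> simp [Xg, Zg, Matrix.mul_apply]

theorem pOp_sq_aux {n : ℕ} (i : Fin n) : pOp i * pOp i = 1 := by
  rw [pOp, tens_mul_aux, ← tens_one_aux]
  congr 1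
  funext k
  split_ifs <;> simp [XX_aux, ZZ_aux]

theorem pOp_anti_aux {n : ℕ} (i j : Fin n) (h : i < j) : pOp i * pOp j = - (pOp j * pOp i) := by
  have key : pOp i * pOp j = (∏ k : Fin n, if k = j then (-1 : ℂ) else 1) • (pOp j * pOp i) := by
    rw [pOp, pOp, tens_mul_aux, tens_mul_aux, ← tens_smul_aux]
    congr 1
    funext k
    rcases lt_trichotomy k j with hk | hk | hk
    · simp [hk, hk.ne]
    · subst hk
      simp [h.not_gt, h.ne', ZX_aux]
    · have h2 := h.trans hk
      simp [hk.not_gt, hk.ne', h2.not_gt, h2.ne']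
  rw [key]; simp

theorem pOp_herm_aux {n : ℕ} (i : Fin n) : (pOp i)ᴴ = pOp i := by
  ext x y
  simp only [Matrix.conjTranspose_apply, pOp, tens, star_prod]
  refine Finset.prod_congr rfl fun k _ => ?_
  generalize x k = a
  generalize y k = b
  split_ifs <;> fin_cases a <;> fin_cases b <;> simp [Xg, Zg]

theorem pOp_zero_aux {n : ℕ} (i : Fin n) : pOp i *ᵥ zeroState n = eSingle i := by
  funext x
  simp only [Matrix.mulVec, dotProduct, zeroState, mul_ite, mul_one, mul_zero,
    Finset.sum_ite_eq', Finset.sum_ite_eq, Finset.mem_univ, if_true, pOp, tens, eSingle]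
  have : ∀ k : Fin n, (if k < i then (1 : Matrix (Fin 2) (Fin 2) ℂ) else if k = i then Xg else Zg)
      (x k) 0 = if x k = (if k = i then 1 else 0) then 1 else 0 := by
    intro k
    generalize x k = a
    rcases lt_trichotomy k i with hk | hk | hk
    · simp [hk, hk.ne, Matrix.one_apply]
    · fin_cases a <;> simp [hk, Xg]
    · fin_cases a <;> simp [hk.not_gt, hk.ne', Zg]
  simp only [this, Finset.prod_ite_zero, funext_iff]
  simp

theorem sum_sq_aux (n : ℕ) :
    (∑ i : Fin n, pOp i) * (∑ i : Fin n, pOp i) = (n : ℂ) • 1 := by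
  set S := ∑ i : Fin n, pOp i with hS
  have h1 : S * S = ∑ i : Fin n, ∑ j : Fin n, pOp i * pOp j := by
    rw [hS, Finset.sum_mul_sum]
  have h2 : S * S = ∑ i : Fin n, ∑ j : Fin n, pOp j * pOp i := by
    rw [h1, Finset.sum_comm]
  have h3 : S * S + S * S = ((n : ℂ) • 1) + (n : ℂ) • 1 := by
    conv_lhs => rw [h1]
    rw [← h1]
    nth_rewrite 1 [h1]
    rw [h2]
    simp only [← Finset.sum_add_distrib]
    have : ∀ i j : Fin n, (pOp i * pOp j + pOp j * pOp i) = if i = j then 1 + 1 else 0 := by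
      intro i j
      rcases lt_trichotomy i j with h | h | h
      · simp [pOp_anti_aux i j h, h.ne]
      · subst h; simp [pOp_sq_aux]
      · simp [pOp_anti_aux j i h, h.ne']
    simp only [this, Finset.sum_ite_eq, Finset.mem_univ, if_true, Finset.sum_const,
      Finset.card_univ, Fintype.card_fin]
    rw [← smul_add, Nat.cast_smul_eq_nsmul]
  rw [← two_smul ℂ, ← two_smul ℂ] at h3
  exact smul_right_injective _ (two_ne_zero (α := ℂ)) h3

/-- `U_{n,1} = (1/√n) Σᵢ I^{⊗(i-1)} ⊗ X ⊗ Z^{⊗(n-i)}` is unitary and maps `|0⟩^{⊗n}`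
to the `n`-qubit W state `|n,1⟩ = (1/√n) Σᵢ |e_i⟩`. -/
theorem stmt11 (n : ℕ) (hn : 1 ≤ n)
    (U : Matrix (Fin n → Fin 2) (Fin n → Fin 2) ℂ)
    (hU : U = ((1 / Real.sqrt n : ℝ) : ℂ) • ∑ i : Fin n, pOp i) :
    Uᴴ * U = 1 ∧
    U *ᵥ zeroState n = ((1 / Real.sqrt n : ℝ) : ℂ) • ∑ i : Fin n, eSingle i := by
  have hn' : (n : ℝ) ≠ 0 := by positivity
  have hs : ((1 / Real.sqrt n : ℝ) : ℂ) * ((1 / Real.sqrt n : ℝ) : ℂ) * (n : ℂ) = 1 := by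
    have : (1 / Real.sqrt n) * (1 / Real.sqrt n) * (n : ℝ) = 1 := by
      rw [div_mul_div_comm, Real.mul_self_sqrt (Nat.cast_nonneg n)]
      field_simp
    exact_mod_cast this
  subst hU
  constructor
  · rw [Matrix.conjTranspose_smul, Matrix.conjTranspose_sum]
    simp only [pOp_herm_aux]
    rw [smul_mul_smul_comm, sum_sq_aux, smul_smul, Complex.star_def, Complex.conj_ofReal, hs,
      one_smul]
  · rw [Matrix.smul_mulVec, Matrix.sum_mulVec]
    simp only [pOp_zero_aux]
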